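/- For every $t > 0$ one has $\int_0^t K_H(t,s)^2\,ds = t^{2H}$. -/

import Mathlib

open MeasureTheory Set

/-- The Euler Beta function `B(x,y) = Γ(x)Γ(y)/Γ(x+y)`. -/
noncomputable def eulerBeta (x y : ℝ) : ℝ := Real.Gamma x * Real.Gamma y / Real.Gamma (x + y)

/-- The normalizing constant `c_H = √(H(2H-1)/B(2-2H, H-1/2))`. -/
noncomputable def cH (H : ℝ) : ℝ :=
  Real.sqrt (H * (2*H - 1) / eulerBeta (2 - 2*H) (H - 1/2))

/-- The fractional Brownian motion kernel:
`K_H(t,s) = c_H s^(1/2-H) ∫_s^t (u-s)^(H-3/2) u^(H-1/2) du` for `0 < s < t`, and `0` otherwise. -/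
noncomputable def KH (H : ℝ) (t s : ℝ) : ℝ :=
  if 0 < s ∧ s < t then
    cH H * s ^ ((1:ℝ)/2 - H) * ∫ u in s..t, (u - s) ^ (H - 3/2) * u ^ (H - 1/2)
  else 0

theorem lintegral_sub_left_rpow {a b p : ℝ} (hab : a ≤ b) (hp : -1 < p) :
    ∫⁻ x in Ioo a b, ENNReal.ofReal ((x - a) ^ p) =
      ENNReal.ofReal ((b - a) ^ (p + 1) / (p + 1)) := by
  have hint : IntervalIntegrable (fun x => (x - a) ^ p) volume a b := by
    have h := (intervalIntegral.intervalIntegrable_rpow' (a := 0) (b := b - a) hp).comp_sub_right a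
    simpa using h
  rw [intervalIntegrable_iff_integrableOn_Ioo_of_le hab] at hint
  rw [← ofReal_integral_eq_lintegral_ofReal hint, ← integral_Ioc_eq_integral_Ioo,
    ← intervalIntegral.integral_of_le hab,
    intervalIntegral.integral_comp_sub_right (fun x => x ^ p) a, sub_self,
    integral_rpow (Or.inl hp), Real.zero_rpow (by linarith), sub_zero]
  filter_upwards [ae_restrict_mem measurableSet_Ioo] with x hx
  exact Real.rpow_nonneg (by linarith [hx.1]) _

theorem lintegral_sub_right_rpow {a b p : ℝ} (hab : a ≤ b) (hp : -1 < p) :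
    ∫⁻ x in Ioo a b, ENNReal.ofReal ((b - x) ^ p) =
      ENNReal.ofReal ((b - a) ^ (p + 1) / (p + 1)) := by
  have hint : IntervalIntegrable (fun x => (b - x) ^ p) volume a b := by
    have h := (intervalIntegral.intervalIntegrable_rpow' (a := b - a) (b := 0) hp).comp_sub_left b
    simpa using h
  rw [intervalIntegrable_iff_integrableOn_Ioo_of_le hab] at hint
  rw [← ofReal_integral_eq_lintegral_ofReal hint, ← integral_Ioc_eq_integral_Ioo,
    ← intervalIntegral.integral_of_le hab,
    intervalIntegral.integral_comp_sub_left (fun x => x ^ p) b, sub_self,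
    integral_rpow (Or.inl hp), Real.zero_rpow (by linarith), sub_zero]
  filter_upwards [ae_restrict_mem measurableSet_Ioo] with x hx
  exact Real.rpow_nonneg (by linarith [hx.2]) _

theorem lintegral_abs_sub_rpow {u t p : ℝ} (hu : u ∈ Ioo 0 t) (hp : -1 < p) :
    ∫⁻ v in Ioo 0 t, ENNReal.ofReal (|u - v| ^ p) =
      ENNReal.ofReal (u ^ (p + 1) / (p + 1)) + ENNReal.ofReal ((t - u) ^ (p + 1) / (p + 1)) := by
  have hdisj : Disjoint (Ioo 0 u) (Ico u t) :=
    Set.disjoint_left.2 fun x hx hx' => absurd hx.2 (not_lt.2 hx'.1)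
  rw [← Ioo_union_Ico_eq_Ioo hu.1 hu.2.le, lintegral_union measurableSet_Ico hdisj,
    setLIntegral_congr (Ioo_ae_eq_Ico (a := u) (b := t)).symm, ← lintegral_sub_left_rpow hu.2.le hp]
  have hl := lintegral_sub_right_rpow hu.1.le hp
  rw [sub_zero] at hl
  rw [← hl]
  congr 1
  · refine setLIntegral_congr_fun measurableSet_Ioo fun x hx => ?_
    rw [abs_of_pos (sub_pos.2 hx.2)]
  · refine setLIntegral_congr_fun measurableSet_Ioo fun x hx => ?_
    rw [abs_sub_comm, abs_of_pos (sub_pos.2 hx.1)]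

theorem lintegral_lintegral_abs_sub_rpow {t p : ℝ} (ht : 0 < t) (hp : -1 < p) :
    ∫⁻ u in Ioo 0 t, ∫⁻ v in Ioo 0 t, ENNReal.ofReal (|u - v| ^ p) =
      ENNReal.ofReal (2 * t ^ (p + 2) / ((p + 1) * (p + 2))) := by
  have hp1 : 0 < p + 1 := by linarith
  have hp2 : 0 < p + 2 := by linarith
  have hq : -1 < p + 1 := by linarith
  rw [setLIntegral_congr_fun measurableSet_Ioo fun u hu => lintegral_abs_sub_rpow hu hp,
    lintegral_add_left (by fun_prop)]
  have hl := lintegral_sub_left_rpow ht.le hq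
  have hr := lintegral_sub_right_rpow ht.le hq
  simp only [sub_zero] at hl hr
  simp only [div_eq_mul_inv _ (p + 1)]
  simp only [ENNReal.ofReal_mul' (inv_nonneg.2 hp1.le)]
  rw [lintegral_mul_const _ (by fun_prop), lintegral_mul_const _ (by fun_prop), hl, hr,
    ← ENNReal.ofReal_mul' (inv_nonneg.2 hp1.le), ← ENNReal.ofReal_add (by positivity) (by positivity)]
  congr 1
  rw [show p + 1 + 1 = p + 2 by ring]
  field_simp
  ring

theorem eulerBeta_pos {x y : ℝ} (hx : 0 < x) (hy : 0 < y) : 0 < eulerBeta x y :=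
  ProbabilityTheory.beta_pos hx hy

theorem lintegral_rpow_mul_one_sub_rpow {x y : ℝ} (hx : 0 < x) (hy : 0 < y) :
    ∫⁻ r in Ioo (0 : ℝ) 1, ENNReal.ofReal (r ^ (x - 1) * (1 - r) ^ (y - 1)) =
      ENNReal.ofReal (eulerBeta x y) := by
  have hB := eulerBeta_pos hx hy
  have h := ProbabilityTheory.lintegral_betaPDF_eq_one hx hy
  rw [ProbabilityTheory.lintegral_betaPDF] at h
  simp only [mul_assoc] at h
  change ∫⁻ r in Ioo (0 : ℝ) 1,
    ENNReal.ofReal (1 / eulerBeta x y * (r ^ (x - 1) * (1 - r) ^ (y - 1))) = 1 at h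
  simp only [ENNReal.ofReal_mul (one_div_nonneg.2 hB.le)] at h
  rw [lintegral_const_mul _ (by fun_prop)] at h
  rw [ENNReal.eq_inv_of_mul_eq_one_left ((mul_comm _ _).trans h), one_div,
    ENNReal.ofReal_inv_of_pos hB, inv_inv]

/-- The Möbius map `s ↦ s (v - u) / (u (v - s))` sends `(0, u)` bijectively onto `(0, 1)`. -/
theorem image_mobius_Ioo {u v : ℝ} (hu : 0 < u) (huv : u < v) :
    (fun s => s * (v - u) / (u * (v - s))) '' Ioo 0 u = Ioo 0 1 := by
  have hvu : 0 < v - u := sub_pos.2 huv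
  ext x
  constructor
  · rintro ⟨s, ⟨hs0, hsu⟩, rfl⟩
    have hvs : 0 < v - s := by linarith
    have hus : 0 < u - s := by linarith
    refine ⟨by positivity, ?_⟩
    rw [div_lt_one (by positivity)]
    nlinarith
  · rintro ⟨hx0, hx1⟩
    have hd : 0 < v - u + x * u := by positivity
    have hv : 0 < v := hu.trans huv
    refine ⟨x * u * v / (v - u + x * u), ⟨by positivity, ?_⟩, ?_⟩
    · rw [div_lt_iff₀ hd]
      nlinarith [mul_pos hu (mul_pos hvu (sub_pos.2 hx1))]
    · have : v - x * u * v / (v - u + x * u) = v * (v - u) / (v - u + x * u) := by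
        field_simp
        ring
      simp only [this]
      field_simp

theorem injOn_mobius_Ioo {u v : ℝ} (hu : 0 < u) (huv : u < v) :
    InjOn (fun s => s * (v - u) / (u * (v - s))) (Ioo 0 u) := by
  intro a ha b hb hab
  have hva : 0 < v - a := by linarith [ha.2]
  have hvb : 0 < v - b := by linarith [hb.2]
  have hvu : 0 < v - u := sub_pos.2 huv
  have hv : 0 < v := hu.trans huv
  simp only at hab
  rw [div_eq_div_iff (by positivity) (by positivity)] at hab
  have : (u * (v - u) * v) * (a - b) = 0 := by linear_combination hab
  rcases mul_eq_zero.1 this with h | h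
  · exact absurd h (by positivity)
  · linarith

theorem hasDerivAt_mobius {u v s : ℝ} (hu : 0 < u) (hsv : s < v) :
    HasDerivAt (fun s => s * (v - u) / (u * (v - s))) ((v - u) * v / (u * (v - s) ^ 2)) s := by
  have hvs : 0 < v - s := by linarith
  have hd : u * (v - s) ≠ 0 := by positivity
  refine (((hasDerivAt_id' s).mul_const (v - u)).fun_div
    (((hasDerivAt_id' s).const_sub v).const_mul u) hd).congr_deriv ?_
  field_simp
  ring

theorem lintegral_rpow_mul_sub_rpow_mul_sub_rpow {H u v : ℝ} (hH : H ∈ Ioo (1 / 2 : ℝ) 1)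
    (hu : 0 < u) (huv : u < v) :
    ∫⁻ s in Ioo 0 u, ENNReal.ofReal
        (s ^ (1 - 2 * H) * (u - s) ^ (H - 3 / 2) * (v - s) ^ (H - 3 / 2)) =
      ENNReal.ofReal (eulerBeta (2 - 2 * H) (H - 1 / 2) *
        ((v - u) ^ (2 * H - 2) * u ^ (1 / 2 - H) * v ^ (1 / 2 - H))) := by
  have hvu : 0 < v - u := sub_pos.2 huv
  have hv : 0 < v := hu.trans huv
  have hB := eulerBeta_pos (x := 2 - 2 * H) (y := H - 1 / 2) (by linarith [hH.2])
    (by linarith [hH.1])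
  rw [ENNReal.ofReal_mul hB.le, ← lintegral_rpow_mul_one_sub_rpow (by linarith [hH.2])
      (by linarith [hH.1]), ← image_mobius_Ioo hu huv,
    lintegral_image_eq_lintegral_abs_deriv_mul measurableSet_Ioo
      (fun s hs => (hasDerivAt_mobius hu (hs.2.trans huv)).hasDerivWithinAt)
      (injOn_mobius_Ioo hu huv),
    ← lintegral_mul_const' _ _ ENNReal.ofReal_ne_top]
  refine setLIntegral_congr_fun measurableSet_Ioo fun s hs => ?_
  have hs0 : 0 < s := hs.1
  have hus : 0 < u - s := sub_pos.2 hs.2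
  have hvs : 0 < v - s := by linarith
  have hone : 1 - s * (v - u) / (u * (v - s)) = v * (u - s) / (u * (v - s)) := by
    field_simp
    ring
  simp only [hone]
  rw [abs_of_pos (by positivity), ← ENNReal.ofReal_mul (by positivity),
    ← ENNReal.ofReal_mul (by positivity)]
  congr 1
  refine Real.log_injOn_pos (mem_Ioi.2 (by positivity)) (mem_Ioi.2 (by positivity)) ?_
  have l1 : Real.log ((v - u) * v / (u * (v - s) ^ 2)) =
      Real.log (v - u) + Real.log v - (Real.log u + 2 * Real.log (v - s)) := by
    rw [Real.log_div (by positivity) (by positivity), Real.log_mul (by positivity) (by positivity),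
      Real.log_mul (by positivity) (by positivity), Real.log_pow]
    norm_num
  have l2 : Real.log (s * (v - u) / (u * (v - s))) =
      Real.log s + Real.log (v - u) - (Real.log u + Real.log (v - s)) := by
    rw [Real.log_div (by positivity) (by positivity), Real.log_mul (by positivity) (by positivity),
      Real.log_mul (by positivity) (by positivity)]
  have l3 : Real.log (v * (u - s) / (u * (v - s))) =
      Real.log v + Real.log (u - s) - (Real.log u + Real.log (v - s)) := by
    rw [Real.log_div (by positivity) (by positivity), Real.log_mul (by positivity) (by positivity),
      Real.log_mul (by positivity) (by positivity)]
  repeat rw [Real.log_mul (by positivity) (by positivity)]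
  repeat rw [Real.log_rpow (by positivity)]
  rw [l1, l2, l3]
  ring

theorem cH_mul_self {H : ℝ} (hH : H ∈ Ioo (1 / 2 : ℝ) 1) :
    cH H * cH H * eulerBeta (2 - 2 * H) (H - 1 / 2) = H * (2 * H - 1) := by
  have hB := eulerBeta_pos (x := 2 - 2 * H) (y := H - 1 / 2) (by linarith [hH.2])
    (by linarith [hH.1])
  have h0 : 0 ≤ H * (2 * H - 1) := mul_nonneg (by linarith [hH.1]) (by linarith [hH.1])
  rw [cH, Real.mul_self_sqrt (div_nonneg h0 hB.le), div_mul_cancel₀ _ hB.ne']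

/-- The `ℝ≥0∞`-valued integrand whose integral over `u ∈ (0, t)` is `KH H t s`. -/
noncomputable def kernelIntegrand (H s u : ℝ) : ENNReal :=
  if s < u then
    ENNReal.ofReal (cH H * s ^ ((1 : ℝ) / 2 - H) * ((u - s) ^ (H - 3 / 2) * u ^ (H - 1 / 2)))
  else 0

theorem measurable_uncurry_kernelIntegrand (H : ℝ) :
    Measurable (Function.uncurry (kernelIntegrand H)) := by
  refine Measurable.ite (measurableSet_lt measurable_fst measurable_snd) ?_ measurable_const
  fun_prop

theorem lintegral_kernelIntegrand_mul_of_lt {H u v t : ℝ} (hH : H ∈ Ioo (1 / 2 : ℝ) 1)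
    (hu : 0 < u) (huv : u < v) (hut : u < t) :
    ∫⁻ s in Ioo 0 t, kernelIntegrand H s u * kernelIntegrand H s v =
      ENNReal.ofReal (H * (2 * H - 1) * (v - u) ^ (2 * H - 2)) := by
  have hv : 0 < v := hu.trans huv
  have hvu : 0 < v - u := sub_pos.2 huv
  have hc : 0 ≤ cH H := Real.sqrt_nonneg _
  have hind : ∀ s, kernelIntegrand H s u * kernelIntegrand H s v =
      (Iio u).indicator (fun s => kernelIntegrand H s u * kernelIntegrand H s v) s := by
    intro s
    by_cases hs : s < u
    · rw [indicator_of_mem (mem_Iio.2 hs)]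
    · rw [indicator_of_notMem (by simpa using hs), kernelIntegrand, if_neg hs, zero_mul]
  have hset : Iio u ∩ Ioo 0 t = Ioo 0 u := by
    ext s
    simp only [mem_inter_iff, mem_Iio, mem_Ioo]
    exact ⟨fun h => ⟨h.2.1, h.1⟩, fun h => ⟨h.2, h.1, h.2.trans hut⟩⟩
  have hpt : ∀ s ∈ Ioo 0 u, kernelIntegrand H s u * kernelIntegrand H s v =
      ENNReal.ofReal (cH H * cH H * (u ^ (H - 1 / 2) * v ^ (H - 1 / 2))) * ENNReal.ofReal
        (s ^ (1 - 2 * H) * (u - s) ^ (H - 3 / 2) * (v - s) ^ (H - 3 / 2)) := by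
    intro s hs
    have hs0 : 0 < s := hs.1
    have hus : 0 < u - s := sub_pos.2 hs.2
    have hvs : 0 < v - s := by linarith
    rw [kernelIntegrand, kernelIntegrand, if_pos hs.2, if_pos (hs.2.trans huv),
      ← ENNReal.ofReal_mul (by positivity), ← ENNReal.ofReal_mul (by positivity)]
    congr 1
    rw [show 1 - 2 * H = (1 / 2 - H) + (1 / 2 - H) by ring, Real.rpow_add hs0]
    ring
  rw [lintegral_congr hind, lintegral_indicator measurableSet_Iio,
    Measure.restrict_restrict measurableSet_Iio, hset,
    setLIntegral_congr_fun measurableSet_Ioo hpt, lintegral_const_mul' _ _ ENNReal.ofReal_ne_top,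
    lintegral_rpow_mul_sub_rpow_mul_sub_rpow hH hu huv, ← ENNReal.ofReal_mul (by positivity)]
  congr 1
  have hcancel : ∀ {x : ℝ}, 0 < x → x ^ (H - 1 / 2) * x ^ (1 / 2 - H) = 1 := fun hx => by
    rw [← Real.rpow_add hx]
    simp
  rw [← cH_mul_self hH]
  calc _ = cH H * cH H * eulerBeta (2 - 2 * H) (H - 1 / 2) * (v - u) ^ (2 * H - 2) *
        (u ^ (H - 1 / 2) * u ^ (1 / 2 - H)) * (v ^ (H - 1 / 2) * v ^ (1 / 2 - H)) := by ring
    _ = _ := by rw [hcancel hu, hcancel hv, mul_one, mul_one]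

theorem lintegral_kernelIntegrand_mul {H u v t : ℝ} (hH : H ∈ Ioo (1 / 2 : ℝ) 1)
    (hu : u ∈ Ioo 0 t) (hv : v ∈ Ioo 0 t) (huv : v ≠ u) :
    ∫⁻ s in Ioo 0 t, kernelIntegrand H s u * kernelIntegrand H s v =
      ENNReal.ofReal (H * (2 * H - 1) * |u - v| ^ (2 * H - 2)) := by
  rcases huv.lt_or_gt with h | h
  · simp only [mul_comm (kernelIntegrand H _ u)]
    rw [lintegral_kernelIntegrand_mul_of_lt hH hv.1 h hv.2, abs_of_pos (sub_pos.2 h)]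
  · rw [lintegral_kernelIntegrand_mul_of_lt hH hu.1 h hu.2, abs_sub_comm,
      abs_of_pos (sub_pos.2 h)]

theorem lintegral_sq_lintegral_kernelIntegrand {H t : ℝ} (hH : H ∈ Ioo (1 / 2 : ℝ) 1)
    (ht : 0 < t) :
    ∫⁻ s in Ioo 0 t, (∫⁻ u in Ioo 0 t, kernelIntegrand H s u) ^ 2 =
      ENNReal.ofReal (t ^ (2 * H)) := by
  have hm := measurable_uncurry_kernelIntegrand H
  have hms : ∀ s, Measurable (kernelIntegrand H s) := fun s => hm.of_uncurry_left
  have hprod : Measurable fun p : (ℝ × ℝ) × ℝ =>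
      kernelIntegrand H p.1.1 p.1.2 * kernelIntegrand H p.1.1 p.2 :=
    (hm.comp measurable_fst).mul (hm.comp (measurable_fst.fst.prodMk measurable_snd))
  have h0 : 0 ≤ H * (2 * H - 1) := mul_nonneg (by linarith [hH.1]) (by linarith [hH.1])
  calc
    _ = ∫⁻ s in Ioo 0 t, ∫⁻ u in Ioo 0 t, ∫⁻ v in Ioo 0 t,
          kernelIntegrand H s u * kernelIntegrand H s v := by
      refine lintegral_congr fun s => ?_
      rw [lintegral_lintegral_mul (hms s).aemeasurable (hms s).aemeasurable, sq]
    _ = ∫⁻ u in Ioo 0 t, ∫⁻ s in Ioo 0 t, ∫⁻ v in Ioo 0 t,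
          kernelIntegrand H s u * kernelIntegrand H s v :=
      lintegral_lintegral_swap hprod.lintegral_prod_right'.aemeasurable
    _ = ∫⁻ u in Ioo 0 t, ∫⁻ v in Ioo 0 t, ∫⁻ s in Ioo 0 t,
          kernelIntegrand H s u * kernelIntegrand H s v := by
      refine lintegral_congr fun u => lintegral_lintegral_swap (Measurable.aemeasurable ?_)
      exact hprod.comp ((measurable_fst.prodMk measurable_const).prodMk measurable_snd)
    _ = ∫⁻ u in Ioo 0 t, ∫⁻ v in Ioo 0 t,
          ENNReal.ofReal (H * (2 * H - 1)) * ENNReal.ofReal (|u - v| ^ (2 * H - 2)) := by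
      refine setLIntegral_congr_fun measurableSet_Ioo fun u hu => lintegral_congr_ae ?_
      filter_upwards [ae_restrict_mem measurableSet_Ioo, ae_restrict_of_ae (Measure.ae_ne volume u)]
        with v hv huv
      rw [lintegral_kernelIntegrand_mul hH hu hv huv, ENNReal.ofReal_mul h0]
    _ = _ := by
      simp only [lintegral_const_mul' _ _ ENNReal.ofReal_ne_top]
      rw [lintegral_lintegral_abs_sub_rpow ht (by linarith [hH.1]), ← ENNReal.ofReal_mul h0]
      congr 1
      have hH0 : H ≠ 0 := by linarith [hH.1]
      have hH1 : 2 * H - 1 ≠ 0 := by linarith [hH.1]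
      rw [show 2 * H - 2 + 1 = 2 * H - 1 by ring, show 2 * H - 2 + 2 = 2 * H by ring, ← mul_div_assoc,
        div_eq_iff (mul_ne_zero hH1 (mul_ne_zero two_ne_zero hH0))]
      ring

theorem lintegral_kernelIntegrand {H s t : ℝ} (hH : 1 / 2 < H) (hs : s ∈ Ioo 0 t) :
    ∫⁻ u in Ioo 0 t, kernelIntegrand H s u = ENNReal.ofReal (KH H t s) := by
  have hc : 0 ≤ cH H := Real.sqrt_nonneg _
  have hs0 : 0 < s := hs.1
  have hset : Ioi s ∩ Ioo 0 t = Ioo s t := by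
    ext u
    simp only [mem_inter_iff, mem_Ioi, mem_Ioo]
    exact ⟨fun h => ⟨h.1, h.2.2⟩, fun h => ⟨h.1, hs.1.trans h.1, h.2⟩⟩
  have hint : IntervalIntegrable (fun u => (u - s) ^ (H - 3 / 2) * u ^ (H - 1 / 2))
      volume s t := by
    refine IntervalIntegrable.mul_continuousOn ?_
      (Real.continuous_rpow_const (by linarith)).continuousOn
    have h := (intervalIntegral.intervalIntegrable_rpow' (a := 0) (b := t - s)
      (show -1 < H - 3 / 2 by linarith)).comp_sub_right s
    simpa using h
  rw [intervalIntegrable_iff_integrableOn_Ioo_of_le hs.2.le] at hint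
  have hnn : 0 ≤ᵐ[volume.restrict (Ioo s t)]
      fun u => (u - s) ^ (H - 3 / 2) * u ^ (H - 1 / 2) := by
    filter_upwards [ae_restrict_mem measurableSet_Ioo] with u hu
    exact mul_nonneg (Real.rpow_nonneg (sub_nonneg.2 hu.1.le) _)
      (Real.rpow_nonneg (hs0.trans hu.1).le _)
  have hind : kernelIntegrand H s = (Ioi s).indicator fun u => ENNReal.ofReal
      (cH H * s ^ ((1 : ℝ) / 2 - H)) *
        ENNReal.ofReal ((u - s) ^ (H - 3 / 2) * u ^ (H - 1 / 2)) := by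
    ext u
    rw [kernelIntegrand, indicator_apply, ← ENNReal.ofReal_mul (by positivity)]
    rfl
  rw [hind, lintegral_indicator measurableSet_Ioi, Measure.restrict_restrict measurableSet_Ioi,
    hset, lintegral_const_mul' _ _ ENNReal.ofReal_ne_top,
    ← ofReal_integral_eq_lintegral_ofReal hint hnn, ← ENNReal.ofReal_mul (by positivity), KH,
    if_pos ⟨hs.1, hs.2⟩, intervalIntegral.integral_of_le hs.2.le, integral_Ioc_eq_integral_Ioo]

theorem KH_nonneg (H t s : ℝ) : 0 ≤ KH H t s := by
  unfold KH
  split_ifs with h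
  · have hc : 0 ≤ cH H := Real.sqrt_nonneg _
    refine mul_nonneg (mul_nonneg hc (Real.rpow_nonneg h.1.le _))
      (intervalIntegral.integral_nonneg h.2.le fun u hu => ?_)
    exact mul_nonneg (Real.rpow_nonneg (sub_nonneg.2 hu.1) _)
      (Real.rpow_nonneg (h.1.le.trans hu.1) _)
  · exact le_rfl

/-- Itô-isometry identity: `∫_0^t K_H(t,s)² ds = t^(2H)` for every `t > 0`. -/
theorem stmt_7 (H : ℝ) (hH : H ∈ Set.Ioo (1/2 : ℝ) 1) (t : ℝ) (ht : 0 < t) :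
    ∫ s in (0:ℝ)..t, (KH H t s)^2 = t ^ (2*H) := by
  have hK : ∀ s ∈ Ioo 0 t,
      KH H t s ^ 2 = ((∫⁻ u in Ioo 0 t, kernelIntegrand H s u) ^ 2).toReal := fun s hs => by
    rw [lintegral_kernelIntegrand hH.1 hs, ENNReal.toReal_pow,
      ENNReal.toReal_ofReal (KH_nonneg H t s)]
  have hmeas : Measurable fun s => (∫⁻ u in Ioo 0 t, kernelIntegrand H s u) ^ 2 :=
    (measurable_uncurry_kernelIntegrand H).lintegral_prod_right'.pow_const 2
  rw [intervalIntegral.integral_of_le ht.le, integral_Ioc_eq_integral_Ioo,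
    setIntegral_congr_fun measurableSet_Ioo hK, integral_toReal hmeas.aemeasurable,
    lintegral_sq_lintegral_kernelIntegrand hH ht, ENNReal.toReal_ofReal (Real.rpow_nonneg ht.le _)]
  filter_upwards [ae_restrict_mem measurableSet_Ioo] with s hs
  rw [lintegral_kernelIntegrand hH.1 hs]
  exact ENNReal.pow_lt_top ENNReal.ofReal_lt_top
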